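/- Let u : ℝⁿ × [0,T] → ℝ be continuous, smooth on ℝⁿ × (0,T], and a solution of the graphical mean curvature flow on ℝⁿ × (0,T], with u(·,0) = u₀. If u₀(x) → +∞ as |x| → +∞, then u(x,t) → +∞ as |x| → +∞ uniformly in t ∈ (0,T]; that is, for every k > 0 there exists R > 0 such that u(x,t) ≥ k whenever |x| ≥ R and t ∈ (0,T]. -/

import Mathlib

open Real Filter Set

noncomputable section

/-- The `i`-th spatial partial derivative of `f : ℝⁿ → ℝ`. -/
def pd (n : ℕ) (f : EuclideanSpace ℝ (Fin n) → ℝ) (i : Fin n)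
    (x : EuclideanSpace ℝ (Fin n)) : ℝ :=
  fderiv ℝ f x (EuclideanSpace.single i 1)

/-- The second spatial partial derivative `∂ᵢ∂ⱼ f`. -/
def pd2 (n : ℕ) (f : EuclideanSpace ℝ (Fin n) → ℝ) (i j : Fin n)
    (x : EuclideanSpace ℝ (Fin n)) : ℝ :=
  pd n (fun y => pd n f j y) i x

/-- The squared norm `|Df|²` of the spatial gradient. -/
def gradSq (n : ℕ) (f : EuclideanSpace ℝ (Fin n) → ℝ)
    (x : EuclideanSpace ℝ (Fin n)) : ℝ :=
  ∑ i, (pd n f i x) ^ 2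

/-- The right-hand side of the graphical mean curvature flow equation:
`Σ_{i,j} (δ_{ij} − ∂ᵢf ∂ⱼf/(1+|Df|²)) ∂ᵢ∂ⱼf`. -/
def mcfRHS (n : ℕ) (f : EuclideanSpace ℝ (Fin n) → ℝ)
    (x : EuclideanSpace ℝ (Fin n)) : ℝ :=
  ∑ i, ∑ j, ((if i = j then (1 : ℝ) else 0)
    - pd n f i x * pd n f j x / (1 + gradSq n f x)) * pd2 n f i j x

/-- `u : ℝⁿ × S → ℝ` (curried, space then time) solves the graphical mean
curvature flow on the time set `S`. -/
def IsMCFSolution (n : ℕ) (u : EuclideanSpace ℝ (Fin n) → ℝ → ℝ) (S : Set ℝ) : Prop :=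
  ∀ x, ∀ t ∈ S, deriv (fun s => u x s) t = mcfRHS n (fun y => u y t) x

theorem nonneg_of_isLocalMin_of_hasDerivAt {φ φ' : ℝ → ℝ} {c a : ℝ}
    (h1 : ∀ s, HasDerivAt φ (φ' s) s) (h2 : HasDerivAt φ' c a) (hmin : IsLocalMin φ a) :
    0 ≤ c := by
  by_contra! hc
  have hd : deriv φ = φ' := funext fun s => (h1 s).deriv
  have hmax : IsLocalMax φ a :=
    isLocalMax_of_deriv_deriv_neg (by rw [hd, h2.deriv]; exact hc) hmin.deriv_eq_zero
      (h1 a).continuousAt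
  have heq : φ =ᶠ[nhds a] fun _ => φ a := by
    filter_upwards [hmin, hmax] with s hs hs' using le_antisymm hs' hs
  have h0 : deriv (deriv φ) a = 0 := by
    rw [heq.deriv.deriv_eq]
    simp
  rw [hd, h2.deriv] at h0
  exact hc.ne h0

theorem fderiv_apply_eq_sum_pd (n : ℕ) (f : EuclideanSpace ℝ (Fin n) → ℝ)
    (x b : EuclideanSpace ℝ (Fin n)) : fderiv ℝ f x b = ∑ i, b i * pd n f i x := by
  have hb : b = ∑ i, b i • EuclideanSpace.single i (1 : ℝ) := by
    ext j
    simp [Finset.sum_apply, Pi.single_apply]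
  conv_lhs => rw [hb]
  simp [pd]

theorem hasDerivAt_line (n : ℕ) {f : EuclideanSpace ℝ (Fin n) → ℝ} (hf : Differentiable ℝ f)
    (x b : EuclideanSpace ℝ (Fin n)) (s : ℝ) :
    HasDerivAt (fun s : ℝ => f (x + s • b)) (∑ i, b i * pd n f i (x + s • b)) s := by
  have hl : HasDerivAt (fun s : ℝ => x + s • b) b s := by
    simpa using ((hasDerivAt_id s).smul_const b).const_add x
  rw [← fderiv_apply_eq_sum_pd]
  exact (hf (x + s • b)).hasFDerivAt.comp_hasDerivAt s hl

theorem differentiable_pd (n : ℕ) {f : EuclideanSpace ℝ (Fin n) → ℝ} (hf : ContDiff ℝ 2 f)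
    (i : Fin n) : Differentiable ℝ (pd n f i) := by
  have h : ContDiff ℝ 1 (fderiv ℝ f) := hf.fderiv_right (by norm_num)
  exact (h.clm_apply contDiff_const).differentiable (by norm_num)

/-- The second-order condition along `b` at a local minimum of the squared distance from
`(x₀, h)` to the graph of `f`. -/
theorem second_variation_nonneg (n : ℕ) {f : EuclideanSpace ℝ (Fin n) → ℝ}
    (hf : ContDiff ℝ 2 f) (x₀ x : EuclideanSpace ℝ (Fin n)) (h : ℝ)
    (hmin : IsLocalMin (fun y => ‖y - x₀‖ ^ 2 + (f y - h) ^ 2) x)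
    (b : EuclideanSpace ℝ (Fin n)) :
    0 ≤ ∑ i, b i ^ 2 + (∑ i, b i * pd n f i x) ^ 2
      + (f x - h) * ∑ i, ∑ j, b i * b j * pd2 n f i j x := by
  have hfd : Differentiable ℝ f := hf.differentiable (by norm_num)
  set ψ : ℝ → ℝ := fun s => ∑ i, b i * pd n f i (x + s • b) with hψ
  have h1 : ∀ s : ℝ, HasDerivAt
      (fun s : ℝ => ‖x + s • b - x₀‖ ^ 2 + (f (x + s • b) - h) ^ 2)
      (2 * inner ℝ (x - x₀) b + 2 * s * ‖b‖ ^ 2 + 2 * (f (x + s • b) - h) * ψ s) s := by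
    intro s
    have e : (fun s : ℝ => ‖x + s • b - x₀‖ ^ 2) =
        fun s : ℝ => ‖x - x₀‖ ^ 2 + s * (2 * inner ℝ (x - x₀) b) + s ^ 2 * ‖b‖ ^ 2 := by
      funext s
      rw [show x + s • b - x₀ = (x - x₀) + s • b by abel, norm_add_sq_real, inner_smul_right,
        norm_smul, mul_pow, Real.norm_eq_abs, sq_abs]
      ring
    have hA : HasDerivAt (fun s : ℝ => ‖x + s • b - x₀‖ ^ 2)
        (2 * inner ℝ (x - x₀) b + 2 * s * ‖b‖ ^ 2) s := by
      rw [e]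
      have := (((hasDerivAt_id s).mul_const (2 * inner ℝ (x - x₀) b)).const_add
        (‖x - x₀‖ ^ 2)).add (((hasDerivAt_id s).pow 2).mul_const (‖b‖ ^ 2))
      exact this.congr_deriv (by simp)
    have hB := ((hasDerivAt_line n hfd x b s).sub_const h).pow 2
    exact (hA.add hB).congr_deriv (by simp [hψ])
  have hψ' : HasDerivAt ψ (∑ i, ∑ j, b i * b j * pd2 n f i j x) 0 := by
    have : HasDerivAt ψ (∑ j, b j * ∑ i, b i * pd n (pd n f j) i (x + (0 : ℝ) • b)) 0 :=
      HasDerivAt.fun_sum fun j _ =>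
        (hasDerivAt_line n (differentiable_pd n hf j) x b 0).const_mul (b j)
    convert this using 1
    rw [Finset.sum_comm]
    refine Finset.sum_congr rfl fun j _ => ?_
    rw [Finset.mul_sum]
    refine Finset.sum_congr rfl fun i _ => ?_
    rw [zero_smul, add_zero, pd2]
    ring
  have h2 : HasDerivAt
      (fun s : ℝ => 2 * inner ℝ (x - x₀) b + 2 * s * ‖b‖ ^ 2 + 2 * (f (x + s • b) - h) * ψ s)
      (2 * ‖b‖ ^ 2 + (2 * ψ 0 * ψ 0 + 2 * (f x - h) *
        ∑ i, ∑ j, b i * b j * pd2 n f i j x)) 0 := by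
    have hA : HasDerivAt (fun s : ℝ => 2 * inner ℝ (x - x₀) b + 2 * s * ‖b‖ ^ 2)
        (2 * ‖b‖ ^ 2) 0 := by
      have := ((((hasDerivAt_id (0 : ℝ)).const_mul 2).mul_const (‖b‖ ^ 2)).const_add
        (2 * inner ℝ (x - x₀) b))
      simpa using this
    have hB := (((hasDerivAt_line n hfd x b 0).sub_const h).const_mul 2).mul hψ'
    exact (hA.add hB).congr_deriv (by simp [hψ])
  have hl : Filter.Tendsto (fun s : ℝ => x + s • b) (nhds 0) (nhds x) := by
    have : Continuous fun s : ℝ => x + s • b := by fun_prop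
    simpa using this.tendsto 0
  have hmin' : IsLocalMin
      (fun s : ℝ => ‖x + s • b - x₀‖ ^ 2 + (f (x + s • b) - h) ^ 2) 0 := by
    filter_upwards [hl.eventually hmin] with s hs
    simpa using hs
  have key := nonneg_of_isLocalMin_of_hasDerivAt h1 h2 hmin'
  have hψ0 : ψ 0 = ∑ i, b i * pd n f i x := by simp [hψ]
  rw [hψ0, EuclideanSpace.real_norm_sq_eq] at key
  nlinarith [key]

/-- `I - c p pᵀ` with `c = 1 / (w (w + 1))`, `w = √(1 + |p|²)`, is the square root of the
coefficient matrix `I - p pᵀ / (1 + |p|²)`. -/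
theorem sum_sqrt_coeff_mul (n : ℕ) (p : Fin n → ℝ) {w c : ℝ} (hw : 0 < w)
    (hw2 : w ^ 2 = 1 + ∑ i, p i ^ 2) (hc : c = 1 / (w * (w + 1))) (i j : Fin n) :
    ∑ k, ((if i = k then (1 : ℝ) else 0) - c * p k * p i) *
        ((if j = k then (1 : ℝ) else 0) - c * p k * p j)
      = (if i = j then (1 : ℝ) else 0) - p i * p j / (1 + ∑ i, p i ^ 2) := by
  have e : ∀ k, ((if i = k then (1 : ℝ) else 0) - c * p k * p i) *
        ((if j = k then (1 : ℝ) else 0) - c * p k * p j)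
      = (if i = k then (if j = k then (1 : ℝ) else 0) else 0)
        - (if i = k then c * p k * p j else 0) - (if j = k then c * p k * p i else 0)
        + c ^ 2 * p i * p j * p k ^ 2 := by
    intro k
    split_ifs <;> ring
  simp only [e, Finset.sum_add_distrib, Finset.sum_sub_distrib, ← Finset.mul_sum,
    Finset.sum_ite_eq, Finset.mem_univ, if_true]
  rw [← hw2, show ∑ k, p k ^ 2 = w ^ 2 - 1 by linarith]
  have : c * (2 - c * (w ^ 2 - 1)) = 1 / w ^ 2 := by
    rw [hc]; field_simp; ring
  simp only [eq_comm (a := j) (b := i)]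
  linear_combination (-p i * p j) * this

theorem mcfRHS_nonneg_at_isLocalMin (n : ℕ) {f : EuclideanSpace ℝ (Fin n) → ℝ}
    (hf : ContDiff ℝ 2 f) (x₀ x : EuclideanSpace ℝ (Fin n)) (h : ℝ)
    (hmin : IsLocalMin (fun y => ‖y - x₀‖ ^ 2 + (f y - h) ^ 2) x) :
    0 ≤ n + (f x - h) * mcfRHS n f x := by
  set p : Fin n → ℝ := fun i => pd n f i x with hp
  have hS : 0 ≤ ∑ i, p i ^ 2 := Finset.sum_nonneg fun i _ => sq_nonneg _
  set w := √(1 + ∑ i, p i ^ 2) with hwdef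
  have hw : 0 < w := Real.sqrt_pos.2 (by linarith)
  have hw2 : w ^ 2 = 1 + ∑ i, p i ^ 2 := Real.sq_sqrt (by linarith)
  obtain ⟨c, hc⟩ : ∃ c, c = 1 / (w * (w + 1)) := ⟨_, rfl⟩
  have hB := sum_sqrt_coeff_mul n p hw hw2 hc
  set B : Fin n → Fin n → ℝ := fun k i => (if i = k then (1 : ℝ) else 0) - c * p k * p i with hBdef
  set A : Fin n → Fin n → ℝ :=
    fun i j => (if i = j then (1 : ℝ) else 0) - p i * p j / (1 + ∑ i, p i ^ 2) with hA
  have hB' : ∀ i j, ∑ k, B k i * B k j = A i j := hB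
  have key : 0 ≤ ∑ k, (∑ i, B k i ^ 2 + (∑ i, B k i * p i) ^ 2
      + (f x - h) * ∑ i, ∑ j, B k i * B k j * pd2 n f i j x) :=
    Finset.sum_nonneg fun k _ =>
      second_variation_nonneg n hf x₀ x h hmin (WithLp.toLp 2 (B k))
  have swap : ∀ M : Fin n → Fin n → ℝ, ∑ k, ∑ i, ∑ j, B k i * B k j * M i j
      = ∑ i, ∑ j, A i j * M i j := by
    intro M
    rw [Finset.sum_comm]
    refine Finset.sum_congr rfl fun i _ => ?_
    rw [Finset.sum_comm]
    refine Finset.sum_congr rfl fun j _ => ?_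
    rw [← hB', Finset.sum_mul]
  have t1 : ∑ k, ∑ i, B k i ^ 2 = n - (∑ i, p i ^ 2) / (1 + ∑ i, p i ^ 2) := by
    rw [Finset.sum_comm]
    simp only [sq (B _ _), hB']
    simp only [hA, if_true, Finset.sum_sub_distrib, ← Finset.sum_div, ← sq]
    simp
  have t2 : ∑ k, (∑ i, B k i * p i) ^ 2 = (∑ i, p i ^ 2) / (1 + ∑ i, p i ^ 2) := by
    have e : ∀ k, (∑ i, B k i * p i) ^ 2 = ∑ i, ∑ j, B k i * B k j * (p i * p j) := by
      intro k
      rw [sq, Finset.sum_mul_sum]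
      refine Finset.sum_congr rfl fun i _ => Finset.sum_congr rfl fun j _ => ?_
      ring
    simp only [e, swap]
    have e2 : ∀ i j, A i j * (p i * p j) = (if i = j then p i * p j else 0)
        - p i ^ 2 * p j ^ 2 / (1 + ∑ i, p i ^ 2) := by
      intro i j
      simp only [hA]
      split_ifs <;> ring
    simp only [e2, Finset.sum_sub_distrib, Finset.sum_ite_eq, Finset.mem_univ, if_true,
      ← Finset.sum_div, ← Finset.mul_sum, ← Finset.sum_mul, ← sq]
    field_simp
    ring
  rw [Finset.sum_add_distrib, Finset.sum_add_distrib, t1, t2, ← Finset.mul_sum, swap] at key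
  have hm : mcfRHS n f x = ∑ i, ∑ j, A i j * pd2 n f i j x := rfl
  rw [hm]
  linarith

/-- A graph moving by mean curvature that starts outside a ball stays outside the ball of squared
radius `r² - (2n + 1) t` with the same centre. -/
theorem sq_radius_le_sq_dist_graph (n : ℕ) (T : ℝ)
    (u : EuclideanSpace ℝ (Fin n) → ℝ → ℝ)
    (hcont : ContinuousOn (fun p : EuclideanSpace ℝ (Fin n) × ℝ => u p.1 p.2)
      (Set.univ ×ˢ Set.Icc 0 T))
    (hsmooth : ContDiffOn ℝ (⊤ : ℕ∞) (fun p : EuclideanSpace ℝ (Fin n) × ℝ => u p.1 p.2)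
      (Set.univ ×ˢ Set.Ioc 0 T))
    (hflow : IsMCFSolution n u (Set.Ioc 0 T))
    (x₀ : EuclideanSpace ℝ (Fin n)) (h r : ℝ) (hr : 0 ≤ r)
    (hball : ∀ x, ‖x - x₀‖ ≤ r → r ^ 2 ≤ (u x 0 - h) ^ 2)
    {t : ℝ} (ht0 : 0 ≤ t) (htT : t < T) :
    r ^ 2 ≤ (u x₀ t - h) ^ 2 + (2 * n + 1) * t := by
  by_contra! hlt
  set G : EuclideanSpace ℝ (Fin n) × ℝ → ℝ :=
    fun p => ‖p.1 - x₀‖ ^ 2 + (u p.1 p.2 - h) ^ 2 + (2 * n + 1) * p.2 with hG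
  have hGc : ContinuousOn G (Metric.closedBall x₀ r ×ˢ Set.Icc 0 t) := by
    have hu : ContinuousOn (fun p : EuclideanSpace ℝ (Fin n) × ℝ => u p.1 p.2)
        (Metric.closedBall x₀ r ×ˢ Set.Icc 0 t) :=
      hcont.mono (Set.prod_mono (Set.subset_univ _) (Set.Icc_subset_Icc_right htT.le))
    fun_prop
  have hmem : (x₀, t) ∈ Metric.closedBall x₀ r ×ˢ Set.Icc 0 t :=
    ⟨Metric.mem_closedBall_self hr, ht0, le_rfl⟩
  obtain ⟨⟨x, s⟩, ⟨hx, hs0, hst⟩, hmin⟩ :=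
    ((isCompact_closedBall x₀ r).prod isCompact_Icc).exists_isMinOn ⟨_, hmem⟩ hGc
  simp only [] at hx hs0 hst
  have hval : G (x, s) < r ^ 2 := by
    refine lt_of_le_of_lt (hmin hmem) ?_
    simpa [hG] using hlt
  simp only [hG] at hval
  have hn : (0 : ℝ) ≤ n := n.cast_nonneg
  have hxr : ‖x - x₀‖ ≤ r := by simpa [dist_eq_norm] using hx
  have hspos : 0 < s := by
    rcases hs0.lt_or_eq with h0 | h0
    · exact h0
    · subst h0
      nlinarith [hball x hxr, sq_nonneg ‖x - x₀‖]
  have hxlt : ‖x - x₀‖ < r := by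
    refine lt_of_pow_lt_pow_left₀ 2 hr ?_
    nlinarith [sq_nonneg (u x s - h), mul_nonneg (by linarith : 0 ≤ 2 * (n : ℝ) + 1) hs0]
  have hsT : s < T := hst.trans_lt htT
  have hmin' : ∀ y, ‖y - x₀‖ ≤ r → ∀ τ ∈ Set.Icc 0 t, G (x, s) ≤ G (y, τ) := fun y hy τ hτ =>
    hmin ⟨by simpa [dist_eq_norm] using hy, hτ⟩
  have hf : ContDiff ℝ 2 (fun y => u y s) := by
    rw [← contDiffOn_univ]
    refine ((hsmooth.comp (contDiff_prodMk_left s).contDiffOn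
      (s := Set.univ) fun y _ => ⟨trivial, hspos, hsT.le⟩).of_le ?_)
    exact WithTop.coe_le_coe.2 le_top
  have hspace : IsLocalMin (fun y => ‖y - x₀‖ ^ 2 + (u y s - h) ^ 2) x := by
    have hnb : ∀ᶠ y in nhds x, ‖y - x₀‖ < r :=
      (by fun_prop : Continuous fun y => ‖y - x₀‖).continuousAt.eventually_lt_const hxlt
    filter_upwards [hnb] with y hy
    have := hmin' y hy.le s ⟨hs0, hst⟩
    simp only [hG] at this
    linarith
  have hell := mcfRHS_nonneg_at_isLocalMin n hf x₀ x h hspace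
  rw [← hflow x s ⟨hspos, hsT.le⟩] at hell
  have hdiff : DifferentiableAt ℝ (fun τ => u x τ) s := by
    have hnb : Set.univ ×ˢ Set.Ioc 0 T ∈ nhds (x, s) :=
      prod_mem_nhds Filter.univ_mem (Ioc_mem_nhds hspos hsT)
    have := (hsmooth.contDiffAt hnb).differentiableAt (by simp)
    exact this.comp s (by fun_prop : DifferentiableAt ℝ (fun τ => (x, τ)) s)
  have hd : HasDerivAt (fun τ => (u x τ - h) ^ 2 + (2 * n + 1) * τ)
      (2 * (u x s - h) * deriv (fun τ => u x τ) s + (2 * n + 1)) s := by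
    have := ((hdiff.hasDerivAt.sub_const h).pow 2).add
      ((hasDerivAt_id s).const_mul (2 * (n : ℝ) + 1))
    exact this.congr_deriv (by simp)
  obtain ⟨τ, hτ, hτ'⟩ : ∃ τ ∈ Set.Ioo 0 s,
      (u x τ - h) ^ 2 + (2 * n + 1) * τ < (u x s - h) ^ 2 + (2 * n + 1) * s := by
    have hsl := (hasDerivAt_iff_tendsto_slope_left_right.1 hd).1.eventually_const_lt
      (by linarith : 0 < 2 * (u x s - h) * deriv (fun τ => u x τ) s + (2 * n + 1))
    obtain ⟨τ, hτs, hτ⟩ := (hsl.and (Ioo_mem_nhdsLT hspos)).exists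
    exact ⟨τ, hτ, (slope_pos_iff_gt hτ.2).1 hτs⟩
  have := hmin' x hxr τ ⟨hτ.1.le, hτ.2.le.trans hst⟩
  simp only [hG] at this
  linarith

/-- **Corollary 4.2.** If `u₀(x) → +∞` as `|x| → +∞`, then
`u(x,t) → +∞` as `|x| → +∞` uniformly in `t ∈ (0,T]`: for every `k > 0`
there is `R > 0` with `u(x,t) ≥ k` whenever `‖x‖ ≥ R` and `t ∈ (0,T]`. -/
theorem mcf_proper_uniformly (n : ℕ) (T : ℝ) (hT : 0 < T)
    (u : EuclideanSpace ℝ (Fin n) → ℝ → ℝ) (u₀ : EuclideanSpace ℝ (Fin n) → ℝ)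
    (hcont : ContinuousOn (fun p : EuclideanSpace ℝ (Fin n) × ℝ => u p.1 p.2)
      (Set.univ ×ˢ Set.Icc 0 T))
    (hsmooth : ContDiffOn ℝ (⊤ : ℕ∞) (fun p : EuclideanSpace ℝ (Fin n) × ℝ => u p.1 p.2)
      (Set.univ ×ˢ Set.Ioc 0 T))
    (hflow : IsMCFSolution n u (Set.Ioc 0 T))
    (hinit : ∀ x, u x 0 = u₀ x)
    (hproper : Filter.Tendsto u₀ (Filter.cocompact _) Filter.atTop) :
    ∀ k : ℝ, 0 < k → ∃ R : ℝ, 0 < R ∧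
      ∀ x, ∀ t ∈ Set.Ioc 0 T, R ≤ ‖x‖ → k ≤ u x t := by
  intro k _
  set r : ℝ := (2 * n + 1) * T + 1 with hr
  have hn : (0 : ℝ) ≤ n := n.cast_nonneg
  have hr1 : 1 ≤ r := by
    have : 0 ≤ (2 * (n : ℝ) + 1) * T := by positivity
    linarith
  have hev := hproper.eventually_ge_atTop (k + r)
  rw [← Metric.cobounded_eq_cocompact, ← comap_norm_atTop, Filter.eventually_comap] at hev
  obtain ⟨R₀, hR₀⟩ := Filter.eventually_atTop.1 hev
  refine ⟨max R₀ 0 + r, by linarith [le_max_right R₀ 0], fun x₀ t ht hx₀ => ?_⟩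
  have hinit' : ∀ x, ‖x - x₀‖ ≤ r → k + r ≤ u x 0 := by
    intro x hx
    rw [hinit]
    refine hR₀ ‖x‖ ?_ x rfl
    have := norm_sub_norm_le x₀ x
    rw [norm_sub_rev] at this
    linarith [le_max_left R₀ 0]
  have hx₀c : ContinuousOn (fun s => u x₀ s) (Set.Icc 0 T) :=
    hcont.comp (by fun_prop : ContinuousOn (fun s : ℝ => (x₀, s)) (Set.Icc 0 T))
      fun s hs => ⟨trivial, hs⟩
  have hlt : ∀ s ∈ Set.Ico 0 T, k ≤ u x₀ s := by
    intro s hs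
    by_contra! hks
    obtain ⟨τ, hτ, hτk⟩ := intermediate_value_Icc' hs.1
      (hx₀c.mono (Set.Icc_subset_Icc_right hs.2.le))
      (show k ∈ Set.Icc (u x₀ s) (u x₀ 0) from
        ⟨hks.le, by linarith [hinit' x₀ (by simp; linarith)]⟩)
    have hτT : τ < T := hτ.2.trans_lt hs.2
    have := sq_radius_le_sq_dist_graph n T u hcont hsmooth hflow x₀ k r (by linarith)
      (fun x hx => by
        have := hinit' x hx
        exact pow_le_pow_left₀ (by linarith) (by linarith) 2) hτ.1 hτT
    simp only at hτk
    rw [hτk] at this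
    nlinarith [mul_le_mul_of_nonneg_left hτT.le (by linarith : 0 ≤ 2 * (n : ℝ) + 1)]
  have hcl : closure (Set.Ico 0 T) = Set.Icc 0 T := closure_Ico hT.ne
  exact le_on_closure (f := fun _ => k) hlt continuousOn_const (hcl ▸ hx₀c)
    (hcl ▸ ⟨ht.1.le, ht.2⟩)
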